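/- Let W ∈ ℝ^{N×N} be symmetric, doubly stochastic, positive semidefinite, with second-largest eigenvalue σ₂(W) ∈ [0,1). Let X⁰ ∈ ℝ^{N×n}, set X^{−1} = X⁰, and define X^{k+1} = (1+θ)·W·X^k − θ·X^{k−1} for k ≥ 0, where θ = 1/(1+√(1−σ₂(W)²)). Let X̄ = (1/N)·𝟏𝟏ᵀ·X⁰ (every row equal to the row-average of X⁰). Then for every k ∈ ℕ, ‖X^k − X̄‖_F ≤ √14·b^k·‖X⁰ − X̄‖_F, where b = 1 − (1 − 1/√2)·√(1−σ₂(W)) and ‖·‖_F is the Frobenius norm. -/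

import Mathlib

open Finset

/-- The second-largest eigenvalue of a symmetric doubly stochastic matrix `W`,
expressed as the maximal Rayleigh quotient over the orthogonal complement of the
all-ones vector (the top eigenvector). -/
noncomputable def sigma2 {N : ℕ} (W : Matrix (Fin N) (Fin N) ℝ) : ℝ :=
  sSup {r : ℝ | ∃ x : EuclideanSpace ℝ (Fin N),
    ‖x‖ = 1 ∧ (∑ i, x i) = 0 ∧ r = ∑ i, ∑ j, W i j * x i * x j}

/-- Frobenius norm of a rectangular real matrix. -/
noncomputable def frobNorm {N n : ℕ} (M : Matrix (Fin N) (Fin n) ℝ) : ℝ :=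
  Real.sqrt (∑ i, ∑ j, (M i j) ^ 2)

theorem scalar_bound (θ s σ l : ℝ) (hs : 0 ≤ s) (hs2 : s ^ 2 = 1 - σ ^ 2)
    (hθ : θ * (1 + s) = 1) (hσ1 : σ < 1) (hl : 0 ≤ l) (hlσ : l ≤ σ)
    (y : ℕ → ℝ) (hy : ∀ k, y (k + 1) = (1 + θ) * (l * y k) - θ * y (k - 1)) (k : ℕ) :
    y k ^ 2 ≤ 14 * θ ^ k * y 0 ^ 2 := by
  have hθ0 : 0 < θ := by
    by_contra h
    nlinarith
  have hF : ∀ k, y k ^ 2 - (1 + θ) * l * y k * y (k - 1) + θ * y (k - 1) ^ 2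
      = θ ^ k * ((1 + θ) * (1 - l) * y 0 ^ 2) := by
    intro k
    induction k with
    | zero => simp; ring
    | succ k ih =>
      rw [hy k]
      simp only [Nat.add_sub_cancel]
      rw [pow_succ]
      linear_combination θ * ih
  have hl2 : l ^ 2 ≤ σ ^ 2 := by gcongr
  have hl1 : l < 1 := by linarith
  have hG1 : (4 * θ - (1 + θ) ^ 2 * l ^ 2) * (1 + s) ^ 2
      = 4 * (1 + s) - (2 + s) ^ 2 * l ^ 2 := by
    have e1 : 4 * θ * (1 + s) ^ 2 = 4 * (1 + s) := by linear_combination 4 * (1 + s) * hθ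
    have e2 : (1 + θ) * (1 + s) = 2 + s := by linear_combination hθ
    rw [← e2]; linear_combination e1
  have hG2 : (3 + 4 * s) * (1 - l ^ 2) ≤ 4 * (1 + s) - (2 + s) ^ 2 * l ^ 2 := by
    nlinarith [mul_nonneg (sq_nonneg l) (sub_nonneg.2 hl2), mul_nonneg (sub_nonneg.2 hl1.le) hl,
      sq_nonneg (1 - l ^ 2)]
  have hs1 : 0 < (1 + s) ^ 2 := by positivity
  have hll : 0 < 1 - l ^ 2 := by nlinarith
  have hG : 0 < 4 * θ - (1 + θ) ^ 2 * l ^ 2 := by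
    have : 0 < (3 + 4 * s) * (1 - l ^ 2) := by positivity
    exact pos_of_mul_pos_left (by rw [hG1]; linarith) hs1.le
  have hK : 4 * θ * ((1 + θ) * (1 - l)) ≤ 14 * (4 * θ - (1 + θ) ^ 2 * l ^ 2) := by
    refine le_of_mul_le_mul_right ?_ hs1
    have e : 4 * θ * ((1 + θ) * (1 - l)) * (1 + s) ^ 2 = 4 * (2 + s) * (1 - l) := by
      have e2 : (1 + θ) * (1 + s) = 2 + s := by linear_combination hθ
      rw [← e2]; linear_combination 4 * (1 - l) * (1 + θ) * (1 + s) * hθ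
    rw [e, mul_assoc 14, hG1]
    have : (2 + s) * (1 - l) * 4 ≤ 14 * ((3 + 4 * s) * (1 - l ^ 2)) := by
      have h1 : 0 ≤ 1 - l := by linarith
      nlinarith [mul_nonneg h1 hs, mul_nonneg h1 hl, mul_nonneg (mul_nonneg h1 hl) hs]
    linarith
  have hlow : (4 * θ - (1 + θ) ^ 2 * l ^ 2) * y k ^ 2
      ≤ 4 * θ * (θ ^ k * ((1 + θ) * (1 - l) * y 0 ^ 2)) := by
    rw [← hF k]
    nlinarith [sq_nonneg ((1 + θ) * l * y k - 2 * θ * y (k - 1))]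
  refine le_of_mul_le_mul_left (hlow.trans ?_) hG
  have : 0 ≤ θ ^ k * y 0 ^ 2 := by positivity
  nlinarith [mul_le_mul_of_nonneg_right hK this]

theorem rate_bound (θ s σ b : ℝ) (hs : 0 ≤ s) (hs2 : s ^ 2 = 1 - σ ^ 2)
    (hθ : θ * (1 + s) = 1) (hσ0 : 0 ≤ σ) (hσ1 : σ < 1)
    (hb : b = 1 - (1 - 1 / Real.sqrt 2) * Real.sqrt (1 - σ)) : 0 ≤ b ∧ θ ≤ b ^ 2 := by
  have ht0 := Real.sqrt_nonneg (1 - σ)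
  have ht2 := Real.sq_sqrt (show 0 ≤ 1 - σ by linarith)
  set t := Real.sqrt (1 - σ)
  have ht1 : t ≤ 1 := by nlinarith
  have hr0 : 0 < 1 / Real.sqrt 2 := by positivity
  have hr2 : (1 / Real.sqrt 2) ^ 2 = 1 / 2 := by
    rw [div_pow, Real.sq_sqrt (by norm_num)]; norm_num
  set r := 1 / Real.sqrt 2
  have hr3 : 0.7 < r := by nlinarith
  have hr4 : r < 0.71 := by nlinarith
  have hts : t ≤ s := by
    refine abs_le_of_sq_le_sq' ?_ hs |>.2
    nlinarith
  refine ⟨by rw [hb]; nlinarith, ?_⟩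
  have h1 : 1 ≤ (1 + t) * b ^ 2 := by
    have e : (1 + t) * b ^ 2 - 1
        = t * ((1 - t) * ((1 - 2 * (1 - r)) - (1 - r) ^ 2 * t)) := by
      rw [hb]; linear_combination (2 * t ^ 2) * hr2
    have : 0 ≤ (1 - 2 * (1 - r)) - (1 - r) ^ 2 * t := by
      have : (1 - r) ^ 2 * t ≤ 0.09 * 1 := by
        apply mul_le_mul _ ht1 ht0 (by norm_num)
        nlinarith
      linarith
    have := mul_nonneg ht0 (mul_nonneg (sub_nonneg.2 ht1) this)
    linarith
  have h2 : 1 ≤ (1 + s) * b ^ 2 := by nlinarith [sq_nonneg b]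
  have : θ * (1 + s) ≤ b ^ 2 * (1 + s) := by linarith
  exact le_of_mul_le_mul_right this (by linarith)

theorem rayleigh_le {N : ℕ} (W : Matrix (Fin N) (Fin N) ℝ) (hWnonneg : ∀ i j, 0 ≤ W i j)
    (hWrow : ∀ i, ∑ j, W i j = 1) (hWcol : ∀ j, ∑ i, W i j = 1)
    (x : EuclideanSpace ℝ (Fin N)) (hx : ∑ i, x i = 0) :
    ∑ i, ∑ j, W i j * x i * x j ≤ sigma2 W * ‖x‖ ^ 2 := by
  have hbdd : BddAbove {r : ℝ | ∃ x : EuclideanSpace ℝ (Fin N),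
    ‖x‖ = 1 ∧ (∑ i, x i) = 0 ∧ r = ∑ i, ∑ j, W i j * x i * x j} := by
    refine ⟨1, ?_⟩
    rintro r ⟨x, hx1, -, rfl⟩
    have hn : ∑ i, x i ^ 2 = 1 := by
      rw [← EuclideanSpace.real_norm_sq_eq, hx1]; norm_num
    have h1 : ∑ i, ∑ j, W i j * x i * x j
        ≤ ∑ i, ∑ j, (W i j * x i ^ 2 + W i j * x j ^ 2) / 2 := by
      refine Finset.sum_le_sum fun i _ => Finset.sum_le_sum fun j _ => ?_
      nlinarith [mul_nonneg (hWnonneg i j) (sq_nonneg (x i - x j))]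
    have h2 : ∑ i, ∑ j, (W i j * x i ^ 2 + W i j * x j ^ 2) / 2 = 1 := by
      simp_rw [← Finset.sum_div, Finset.sum_add_distrib]
      rw [Finset.sum_comm (f := fun i j => W i j * x j ^ 2)]
      simp_rw [← Finset.sum_mul, hWrow, hWcol]
      simp [hn]
    linarith
  by_cases h0 : x = 0
  · subst h0; simp
  have hn : 0 < ‖x‖ := norm_pos_iff.2 h0
  have := le_csSup hbdd ⟨(‖x‖⁻¹ : ℝ) • x, by rw [norm_smul]; simp [hn.ne'],
    by simp [← Finset.mul_sum, hx], rfl⟩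
  have e : ∑ i, ∑ j, W i j * ((‖x‖⁻¹ : ℝ) • x) i * ((‖x‖⁻¹ : ℝ) • x) j
      = (∑ i, ∑ j, W i j * x i * x j) * (‖x‖⁻¹) ^ 2 := by
    simp only [PiLp.smul_apply, smul_eq_mul, Finset.sum_mul]
    refine Finset.sum_congr rfl fun i _ => Finset.sum_congr rfl fun j _ => ?_
    ring
  rw [e, inv_pow, ← div_eq_mul_inv, div_le_iff₀ (by positivity)] at this
  exact this

theorem eig_cases {N : ℕ} (W : Matrix (Fin N) (Fin N) ℝ) (hWnonneg : ∀ i j, 0 ≤ W i j)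
    (hWrow : ∀ i, ∑ j, W i j = 1) (hWcol : ∀ j, ∑ i, W i j = 1) (hσ1 : sigma2 W < 1)
    (v : EuclideanSpace ℝ (Fin N)) (hv : ‖v‖ = 1) (l : ℝ)
    (hl : ∀ i, ∑ j, W i j * v j = l * v i) :
    l ≤ sigma2 W ∨ ∀ x : Fin N → ℝ, ∑ i, x i = 0 → ∑ i, v i * x i = 0 := by
  by_cases h : ∑ i, v i = 0
  · left
    have := rayleigh_le W hWnonneg hWrow hWcol v h
    have e : ∑ i, ∑ j, W i j * v i * v j = l * ‖v‖ ^ 2 := by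
      rw [EuclideanSpace.real_norm_sq_eq, Finset.mul_sum]
      refine Finset.sum_congr rfl fun i _ => ?_
      have : ∑ j, W i j * v i * v j = v i * ∑ j, W i j * v j := by
        rw [Finset.mul_sum]; exact Finset.sum_congr rfl fun j _ => by ring
      rw [this, hl]; ring
    rw [e, hv] at this
    simpa using this
  · right
    have hl1 : l = 1 := by
      have e : ∑ i, ∑ j, W i j * v j = ∑ i, l * v i := Finset.sum_congr rfl fun i _ => hl i
      rw [Finset.sum_comm] at e
      simp_rw [← Finset.sum_mul, hWcol, ← Finset.mul_sum, one_mul] at e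
      exact mul_right_cancel₀ h (by linarith)
    subst hl1
    have hN : (N : ℝ) ≠ 0 := by
      rintro h0
      have : N = 0 := by exact_mod_cast h0
      subst this
      simp at h
    obtain ⟨c, hc⟩ : ∃ c : ℝ, c = (N : ℝ)⁻¹ * ∑ i, v i := ⟨_, rfl⟩
    let w : EuclideanSpace ℝ (Fin N) := WithLp.toLp 2 fun i => v i - c
    have hw : ∀ i, w i = v i - c := fun i => rfl
    have hws : ∑ i, w i = 0 := by
      simp only [hw, Finset.sum_sub_distrib, Finset.sum_const, Finset.card_univ, Fintype.card_fin,
        nsmul_eq_mul, hc]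
      field_simp
      simp
    have hWw : ∀ i, ∑ j, W i j * w j = w i := by
      intro i
      simp only [hw, mul_sub, Finset.sum_sub_distrib, ← Finset.sum_mul, hWrow, hl, one_mul]
    have := rayleigh_le W hWnonneg hWrow hWcol w hws
    have e : ∑ i, ∑ j, W i j * w i * w j = ‖w‖ ^ 2 := by
      rw [EuclideanSpace.real_norm_sq_eq]
      refine Finset.sum_congr rfl fun i _ => ?_
      have : ∑ j, W i j * w i * w j = w i * ∑ j, W i j * w j := by
        rw [Finset.mul_sum]; exact Finset.sum_congr rfl fun j _ => by ring
      rw [this, hWw]; ring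
    rw [e] at this
    have hw0 : ‖w‖ ^ 2 = 0 := by nlinarith [sq_nonneg ‖w‖]
    have hw0 : w = 0 := by simpa using hw0
    intro x hx
    have hvc : ∀ i, v i = c := fun i => by
      have := hw i
      rw [hw0] at this
      simp at this; linarith
    simp only [hvc, ← Finset.mul_sum, hx, mul_zero]

/-- linear convergence of accelerated gossip.
Here `X (k-1)` at `k = 0` is `X 0`, encoding `X^{−1} = X⁰`. -/
theorem stmt_5 (N n : ℕ) (W : Matrix (Fin N) (Fin N) ℝ)
    (hWsymm : W.IsSymm) (hWnonneg : ∀ i j, 0 ≤ W i j)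
    (hWrow : ∀ i, ∑ j, W i j = 1) (hWcol : ∀ j, ∑ i, W i j = 1)
    (hWpsd : W.PosSemidef)
    (hσ0 : 0 ≤ sigma2 W) (hσ1 : sigma2 W < 1)
    (θ : ℝ) (hθ : θ = 1 / (1 + Real.sqrt (1 - sigma2 W ^ 2)))
    (X : ℕ → Matrix (Fin N) (Fin n) ℝ)
    (hrec : ∀ k : ℕ, X (k + 1) = (1 + θ) • (W * X k) - θ • X (k - 1))
    (Xbar : Matrix (Fin N) (Fin n) ℝ)
    (hXbar : ∀ i j, Xbar i j = (N : ℝ)⁻¹ * ∑ i', X 0 i' j)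
    (b : ℝ) (hb : b = 1 - (1 - 1 / Real.sqrt 2) * Real.sqrt (1 - sigma2 W)) :
    ∀ k : ℕ, frobNorm (X k - Xbar) ≤ Real.sqrt 14 * b ^ k * frobNorm (X 0 - Xbar) := by
  have hs := Real.sqrt_nonneg (1 - sigma2 W ^ 2)
  have hs2 := Real.sq_sqrt (show 0 ≤ 1 - sigma2 W ^ 2 by nlinarith)
  set s := Real.sqrt (1 - sigma2 W ^ 2) with hsdef
  have hθ' : θ * (1 + s) = 1 := by
    rw [hθ]; field_simp
  obtain ⟨hb0, hθb⟩ := rate_bound θ s _ b hs hs2 hθ' hσ0 hσ1 hb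
  have hθ0 : 0 ≤ θ := by rw [hθ]; positivity
  have hH : W.IsHermitian := hWpsd.1
  let V := hH.eigenvectorBasis
  have hV : ∀ i a, ∑ c, W a c * V i c = hH.eigenvalues i * V i a := by
    intro i a
    have := congrFun (hH.mulVec_eigenvectorBasis i) a
    simpa [Matrix.mulVec, dotProduct] using this
  have hpars : ∀ z : Fin N → ℝ, ∑ i, (∑ a, V i a * z a) ^ 2 = ∑ a, z a ^ 2 := by
    intro z
    have := V.sum_sq_norm_inner_right (WithLp.toLp 2 z)
    rw [EuclideanSpace.real_norm_sq_eq] at this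
    rw [← this]
    refine Finset.sum_congr rfl fun i _ => ?_
    simp [PiLp.inner_apply, mul_comm]
  have hWX : ∀ a j, ∑ c, W a c * Xbar c j = Xbar a j := by
    intro a j
    simp only [hXbar, ← Finset.sum_mul, hWrow, one_mul]
  let y : Fin N → Fin n → ℕ → ℝ := fun i j k => ∑ a, V i a * (X k a j - Xbar a j)
  have hy : ∀ i j k, y i j (k + 1)
      = (1 + θ) * (hH.eigenvalues i * y i j k) - θ * y i j (k - 1) := by
    intro i j k
    have e1 : hH.eigenvalues i * y i j k
        = ∑ a, V i a * ∑ c, W a c * (X k c j - Xbar c j) := by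
      simp only [y, Finset.mul_sum]
      rw [Finset.sum_comm]
      refine Finset.sum_congr rfl fun c _ => ?_
      rw [← mul_assoc, ← hV, Finset.sum_mul]
      refine Finset.sum_congr rfl fun a _ => ?_
      rw [← hWsymm.apply a c]; ring
    rw [e1]
    simp only [y]
    rw [Finset.mul_sum, Finset.mul_sum, ← Finset.sum_sub_distrib]
    refine Finset.sum_congr rfl fun a _ => ?_
    rw [hrec k]
    simp only [mul_sub, Finset.sum_sub_distrib, hWX, Matrix.sub_apply, Matrix.smul_apply,
      Matrix.mul_apply, smul_eq_mul]
    ring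
  have hmean : ∀ j, ∑ a, (X 0 a j - Xbar a j) = 0 := by
    intro j
    rcases Nat.eq_zero_or_pos N with h | h
    · subst h; simp
    · simp only [hXbar, Finset.sum_sub_distrib, Finset.sum_const, Finset.card_univ,
        Fintype.card_fin, nsmul_eq_mul]
      field_simp
      simp
  have hyb : ∀ i j k, y i j k ^ 2 ≤ 14 * θ ^ k * y i j 0 ^ 2 := by
    intro i j k
    rcases eig_cases W hWnonneg hWrow hWcol hσ1 (V i) (V.orthonormal.1 i) _ (hV i) with h | h
    · exact scalar_bound θ s _ _ hs hs2 hθ' hσ1 (hWpsd.eigenvalues_nonneg i) h _ (hy i j) k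
    · have h0 : y i j 0 = 0 := h _ (hmean j)
      have : ∀ k, y i j k = 0 := by
        intro k
        induction k using Nat.strong_induction_on with
        | _ k ih =>
          cases k with
          | zero => exact h0
          | succ k => rw [hy, ih k (by omega), ih (k - 1) (by omega)]; simp
      simp [this]
  have hfr : ∀ k, ∑ a, ∑ j, (X k - Xbar) a j ^ 2 = ∑ j, ∑ i, y i j k ^ 2 := by
    intro k
    rw [Finset.sum_comm]
    refine Finset.sum_congr rfl fun j _ => ?_
    rw [← hpars]
    simp [y]
  intro k
  unfold frobNorm
  rw [hfr, hfr]
  refine Real.sqrt_le_iff.2 ⟨by positivity, ?_⟩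
  rw [mul_pow, mul_pow, Real.sq_sqrt (by norm_num), Real.sq_sqrt (by positivity)]
  rw [Finset.mul_sum]
  refine Finset.sum_le_sum fun j _ => ?_
  rw [Finset.mul_sum]
  refine Finset.sum_le_sum fun i _ => (hyb i j k).trans ?_
  have : θ ^ k ≤ (b ^ k) ^ 2 := by
    rw [← pow_mul, mul_comm k 2, pow_mul]
    gcongr
  gcongr
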